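/- Let A and B be normal fanning frames with coefficient curves P_2^A,…,P_k^A and P_2^B,…,P_k^B respectively (their coefficients P_1 vanish by normality). Then there exists an invertible (kn)×(kn) real matrix T such that for every t the span of the columns of T·A(t) equals the span of the columns of B(t), if and only if there exists a constant invertible n×n real matrix X such that P_i^B(t) = X⁻¹ P_i^A(t) X for all t ∈ ℝ and all 2 ≤ i ≤ k. (This is the congruence theorem: two fanning curves in Gr(n, ℝ^{kn}) are congruent iff the Schwarzians and the invariants h_1,…,h_{k−2} of any two of their normal frames are simultaneously conjugate by a constant invertible matrix, where for a normal frame the Schwarzian is 2P_2 and h_j = P_{j+2}.) -/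

import Mathlib

open Matrix

noncomputable def mderiv {M N : ℕ} (A : ℝ → Matrix (Fin M) (Fin N) ℝ) :
    ℝ → Matrix (Fin M) (Fin N) ℝ :=
  fun t => Matrix.of fun i j => deriv (fun s => A s i j) t

noncomputable def dmat {M N : ℕ} (i : ℕ) (A : ℝ → Matrix (Fin M) (Fin N) ℝ) :
    ℝ → Matrix (Fin M) (Fin N) ℝ :=
  mderiv^[i] A

def MatSmooth {M N : ℕ} (A : ℝ → Matrix (Fin M) (Fin N) ℝ) : Prop :=
  ∀ i j, ContDiff ℝ (⊤ : ℕ∞) fun t => A t i j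

def juxt (k n : ℕ) (B : Fin k → Matrix (Fin (k * n)) (Fin n) ℝ) :
    Matrix (Fin (k * n)) (Fin (k * n)) ℝ :=
  Matrix.of fun r c => B (finProdFinEquiv.symm c).1 r (finProdFinEquiv.symm c).2

noncomputable def frameMat (k n : ℕ) (A : ℝ → Matrix (Fin (k * n)) (Fin n) ℝ) (t : ℝ) :
    Matrix (Fin (k * n)) (Fin (k * n)) ℝ :=
  juxt k n fun i => dmat (i : ℕ) A t

def IsFanning (k n : ℕ) (A : ℝ → Matrix (Fin (k * n)) (Fin n) ℝ) : Prop :=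
  MatSmooth A ∧ ∀ t, IsUnit (frameMat k n A t)

def IsCoeffs (k n : ℕ) (A : ℝ → Matrix (Fin (k * n)) (Fin n) ℝ)
    (P : ℕ → ℝ → Matrix (Fin n) (Fin n) ℝ) : Prop :=
  (∀ i ∈ Finset.Icc 1 k, MatSmooth (P i)) ∧
  ∀ t, dmat k A t + ∑ i ∈ Finset.Icc 1 k, (k.choose i : ℝ) • (dmat (k - i) A t * P i t) = 0

section Calculus

variable {L M N : ℕ}

lemma MatSmooth.differentiable {A : ℝ → Matrix (Fin M) (Fin N) ℝ} (hA : MatSmooth A)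
    (i : Fin M) (j : Fin N) : Differentiable ℝ fun t => A t i j :=
  (hA i j).differentiable (by simp)

lemma matSmooth_const (A : Matrix (Fin M) (Fin N) ℝ) : MatSmooth fun _ => A :=
  fun _ _ => contDiff_const

lemma MatSmooth.mul {A : ℝ → Matrix (Fin L) (Fin M) ℝ} {B : ℝ → Matrix (Fin M) (Fin N) ℝ}
    (hA : MatSmooth A) (hB : MatSmooth B) : MatSmooth fun t => A t * B t := by
  intro i j
  simp only [Matrix.mul_apply]
  exact ContDiff.sum fun l _ => (hA i l).mul (hB l j)

lemma MatSmooth.mderiv {A : ℝ → Matrix (Fin M) (Fin N) ℝ} (hA : MatSmooth A) :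
    MatSmooth (mderiv A) :=
  fun i j => ((contDiff_infty_iff_deriv (𝕜 := ℝ)).1 (hA i j)).2

lemma dmat_zero (A : ℝ → Matrix (Fin M) (Fin N) ℝ) : dmat 0 A = A := rfl

lemma dmat_succ (i : ℕ) (A : ℝ → Matrix (Fin M) (Fin N) ℝ) :
    dmat (i + 1) A = mderiv (dmat i A) :=
  Function.iterate_succ_apply' _ _ _

lemma MatSmooth.dmat {A : ℝ → Matrix (Fin M) (Fin N) ℝ} (hA : MatSmooth A) (i : ℕ) :
    MatSmooth (dmat i A) := by
  induction i with
  | zero => exact hA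
  | succ i ih => rw [dmat_succ]; exact ih.mderiv

lemma mderiv_const (A : Matrix (Fin M) (Fin N) ℝ) : mderiv (fun _ => A) = fun _ => 0 := by
  ext t i j
  simp [mderiv]

lemma mderiv_mul {A : ℝ → Matrix (Fin L) (Fin M) ℝ} {B : ℝ → Matrix (Fin M) (Fin N) ℝ}
    (hA : MatSmooth A) (hB : MatSmooth B) :
    mderiv (fun t => A t * B t) = fun t => A t * mderiv B t + mderiv A t * B t := by
  ext t i j
  simp only [mderiv, Matrix.of_apply, Matrix.mul_apply, Matrix.add_apply]
  rw [deriv_fun_sum fun l _ => (hA.differentiable i l t).fun_mul (hB.differentiable l j t),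
    ← Finset.sum_add_distrib]
  refine Finset.sum_congr rfl fun l _ => ?_
  rw [deriv_fun_mul (hA.differentiable i l t) (hB.differentiable l j t), add_comm]

lemma mderiv_sum_nsmul {ι : Type*} (s : Finset ι) (c : ι → ℕ)
    (f : ι → ℝ → Matrix (Fin M) (Fin N) ℝ) (hf : ∀ i, MatSmooth (f i)) :
    mderiv (fun t => ∑ i ∈ s, c i • f i t) = fun t => ∑ i ∈ s, c i • mderiv (f i) t := by
  ext t i j
  simp only [mderiv, Matrix.of_apply, Matrix.sum_apply, Matrix.smul_apply, nsmul_eq_mul]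
  rw [deriv_fun_sum fun l _ => ((hf l).differentiable i j t).const_mul _]
  exact Finset.sum_congr rfl fun l _ => deriv_const_mul _ ((hf l).differentiable i j t)

/-- Leibniz rule for the iterated derivative of a product of matrix curves. -/
lemma dmat_mul {A : ℝ → Matrix (Fin L) (Fin M) ℝ} {B : ℝ → Matrix (Fin M) (Fin N) ℝ}
    (hA : MatSmooth A) (hB : MatSmooth B) (m : ℕ) :
    dmat m (fun t => A t * B t) = fun t =>
      ∑ p ∈ Finset.HasAntidiagonal.antidiagonal m, m.choose p.1 • (dmat p.1 A t * dmat p.2 B t) := by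
  induction m with
  | zero => funext t; simp [dmat_zero]
  | succ m ih =>
    rw [dmat_succ, ih, mderiv_sum_nsmul _ _ (fun p : ℕ × ℕ => fun t => dmat p.1 A t * dmat p.2 B t)
      fun p => (hA.dmat p.1).mul (hB.dmat p.2)]
    funext t
    rw [Finset.sum_antidiagonal_choose_succ_nsmul fun i j => dmat i A t * dmat j B t,
      ← Finset.sum_add_distrib]
    refine Finset.sum_congr rfl fun p hp => ?_
    rw [Nat.choose_symm_of_eq_add (Finset.HasAntidiagonal.mem_antidiagonal.1 hp).symm,
      mderiv_mul (hA.dmat p.1) (hB.dmat p.2), dmat_succ, dmat_succ, ← smul_add]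

lemma dmat_mul_const {A : ℝ → Matrix (Fin L) (Fin M) ℝ} (hA : MatSmooth A)
    (X : Matrix (Fin M) (Fin N) ℝ) (m : ℕ) :
    dmat m (fun t => A t * X) = fun t => dmat m A t * X := by
  induction m with
  | zero => rfl
  | succ m ih =>
    rw [dmat_succ, dmat_succ, ih, mderiv_mul (hA.dmat m) (matSmooth_const X), mderiv_const]
    simp

lemma dmat_const_mul {A : ℝ → Matrix (Fin M) (Fin N) ℝ} (hA : MatSmooth A)
    (T : Matrix (Fin L) (Fin M) ℝ) (m : ℕ) :
    dmat m (fun t => T * A t) = fun t => T * dmat m A t := by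
  induction m with
  | zero => rfl
  | succ m ih =>
    rw [dmat_succ, dmat_succ, ih, mderiv_mul (matSmooth_const T) (hA.dmat m), mderiv_const]
    simp

lemma eq_of_mderiv_eq_zero {A : ℝ → Matrix (Fin M) (Fin N) ℝ} (hA : MatSmooth A)
    (h : ∀ t, mderiv A t = 0) (s t : ℝ) : A s = A t := by
  ext i j
  exact is_const_of_deriv_eq_zero (hA.differentiable i j) (fun u => congrFun₂ (h u) i j) s t

lemma MatSmooth.det {A : ℝ → Matrix (Fin M) (Fin M) ℝ} (hA : MatSmooth A) :
    ContDiff ℝ (⊤ : ℕ∞) fun t => (A t).det := by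
  simp only [Matrix.det_apply']
  exact ContDiff.sum fun σ _ => contDiff_const.mul (contDiff_prod fun i _ => hA _ _)

lemma MatSmooth.inv {A : ℝ → Matrix (Fin M) (Fin M) ℝ} (hA : MatSmooth A)
    (hu : ∀ t, IsUnit (A t)) : MatSmooth fun t => (A t)⁻¹ := by
  intro i j
  simp only [Matrix.inv_def, Matrix.smul_apply, smul_eq_mul, Ring.inverse_eq_inv',
    Matrix.adjugate_apply]
  refine (hA.det.inv fun t => ((Matrix.isUnit_iff_isUnit_det _).1 (hu t)).ne_zero).mul
    (MatSmooth.det fun a b => ?_)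
  by_cases h : a = j
  · subst h
    simpa using contDiff_const
  · simpa [Matrix.updateRow_ne h] using hA a b

end Calculus

section Frames

variable {k n : ℕ}

lemma juxt_apply (F : Fin k → Matrix (Fin (k * n)) (Fin n) ℝ) (r : Fin (k * n)) (i : Fin k)
    (b : Fin n) : juxt k n F r (finProdFinEquiv (i, b)) = F i r b := by
  simp only [juxt, Matrix.of_apply, Equiv.symm_apply_apply]

/-- The `j`-th block of `n` rows of the inverse of `M`. -/
noncomputable def invRows (M : Matrix (Fin (k * n)) (Fin (k * n)) ℝ) (j : Fin k) :
    Matrix (Fin n) (Fin (k * n)) ℝ :=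
  Matrix.of fun a r => M⁻¹ (finProdFinEquiv (j, a)) r

lemma invRows_mul {F : Fin k → Matrix (Fin (k * n)) (Fin n) ℝ} (hF : IsUnit (juxt k n F))
    (i j : Fin k) : invRows (juxt k n F) j * F i = if j = i then 1 else 0 := by
  ext a b
  have h := congrFun₂ (Matrix.nonsing_inv_mul _ ((Matrix.isUnit_iff_isUnit_det _).1 hF))
    (finProdFinEquiv (j, a)) (finProdFinEquiv (i, b))
  rw [Matrix.mul_apply, Matrix.one_apply] at h
  simp only [EmbeddingLike.apply_eq_iff_eq, Prod.mk.injEq] at h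
  rw [Matrix.mul_apply]
  refine Eq.trans ?_ (h.trans ?_)
  · simp only [invRows, Matrix.of_apply, juxt_apply]
  · split_ifs <;> simp_all [Matrix.one_apply]

lemma isUnit_juxt_of_mul_eq {F : Fin k → Matrix (Fin (k * n)) (Fin n) ℝ}
    (R : Fin k → Matrix (Fin n) (Fin (k * n)) ℝ)
    (hR : ∀ i j, R j * F i = if j = i then 1 else 0) : IsUnit (juxt k n F) := by
  have h : (Matrix.of fun r c => R (finProdFinEquiv.symm r).1 (finProdFinEquiv.symm r).2 c) *
      juxt k n F = 1 := by
    ext r c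
    obtain ⟨⟨j, a⟩, rfl⟩ := finProdFinEquiv.surjective r
    obtain ⟨⟨i, b⟩, rfl⟩ := finProdFinEquiv.surjective c
    have h := congrFun₂ (hR i j) a b
    rw [Matrix.mul_apply] at h ⊢
    refine Eq.trans ?_ (h.trans ?_)
    · simp only [Matrix.of_apply, juxt_apply, Equiv.symm_apply_apply]
    · split_ifs <;> simp_all [Matrix.one_apply]
  exact (Matrix.isUnit_iff_isUnit_det _).2 (Matrix.isUnit_det_of_left_inverse h)

lemma mul_juxt (T : Matrix (Fin (k * n)) (Fin (k * n)) ℝ)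
    (F : Fin k → Matrix (Fin (k * n)) (Fin n) ℝ) :
    T * juxt k n F = juxt k n fun i => T * F i := by
  ext r c
  simp [juxt, Matrix.mul_apply]

lemma juxt_injective : Function.Injective (juxt k n) := by
  intro F G h
  ext i r b
  simpa only [juxt_apply] using congrFun₂ h r (finProdFinEquiv (i, b))

variable {A B : ℝ → Matrix (Fin (k * n)) (Fin n) ℝ} {P Q : ℕ → ℝ → Matrix (Fin n) (Fin n) ℝ}

lemma MatSmooth.frameMat (hA : MatSmooth A) : MatSmooth (frameMat k n A) :=
  fun _ _ => hA.dmat _ _ _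

lemma IsFanning.const_mul (hA : IsFanning k n A) {T : Matrix (Fin (k * n)) (Fin (k * n)) ℝ}
    (hT : IsUnit T) : IsFanning k n fun t => T * A t := by
  refine ⟨(matSmooth_const T).mul hA.1, fun t => ?_⟩
  have h : _root_.frameMat k n (fun t => T * A t) t = T * _root_.frameMat k n A t := by
    simp only [_root_.frameMat, mul_juxt, dmat_const_mul hA.1]
  rw [h]
  exact hT.mul (hA.2 t)

lemma IsFanning.mul_const (hA : IsFanning k n A) {X : Matrix (Fin n) (Fin n) ℝ}
    (hX : IsUnit X) : IsFanning k n fun t => A t * X := by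
  refine ⟨hA.1.mul (matSmooth_const X), fun t => ?_⟩
  refine isUnit_juxt_of_mul_eq (fun j => X⁻¹ * invRows (_root_.frameMat k n A t) j) fun i j => ?_
  rw [dmat_mul_const hA.1, Matrix.mul_assoc, ← Matrix.mul_assoc _ _ X, _root_.frameMat,
    invRows_mul (F := fun i : Fin k => dmat (i : ℕ) A t) (hA.2 t)]
  split_ifs
  · simp [Matrix.nonsing_inv_mul _ ((Matrix.isUnit_iff_isUnit_det _).1 hX)]
  · simp

lemma IsFanning.exists_invRows (hA : IsFanning k n A) (j : ℕ) (hj : j < k) :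
    ∃ R : ℝ → Matrix (Fin n) (Fin (k * n)) ℝ, MatSmooth R ∧
      ∀ i < k, ∀ t, R t * dmat i A t = if j = i then 1 else 0 := by
  refine ⟨fun t => invRows (_root_.frameMat k n A t) ⟨j, hj⟩,
    fun a r => hA.1.frameMat.inv hA.2 _ _, fun i hi t => ?_⟩
  simpa [_root_.frameMat] using
    invRows_mul (F := fun i : Fin k => dmat (i : ℕ) A t) (hA.2 t) ⟨i, hi⟩ ⟨j, hj⟩

lemma IsCoeffs.const_mul (hP : IsCoeffs k n A P) (hA : MatSmooth A)
    (T : Matrix (Fin (k * n)) (Fin (k * n)) ℝ) : IsCoeffs k n (fun t => T * A t) P := by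
  refine ⟨hP.1, fun t => ?_⟩
  have h := congrArg (T * ·) (hP.2 t)
  simpa [dmat_const_mul hA, Matrix.mul_add, Matrix.mul_sum, Matrix.mul_assoc] using h

lemma IsCoeffs.mul_const (hP : IsCoeffs k n A P) (hA : MatSmooth A)
    {X : Matrix (Fin n) (Fin n) ℝ} (hX : IsUnit X) :
    IsCoeffs k n (fun t => A t * X) fun i t => X⁻¹ * P i t * X := by
  refine ⟨fun i hi => ((matSmooth_const _).mul (hP.1 i hi)).mul (matSmooth_const X), fun t => ?_⟩
  have h := congrArg (· * X) (hP.2 t)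
  have hX' (Y : Matrix (Fin n) (Fin n) ℝ) : X * (X⁻¹ * Y) = Y := by
    rw [← Matrix.mul_assoc, Matrix.mul_nonsing_inv _ ((Matrix.isUnit_iff_isUnit_det _).1 hX),
      Matrix.one_mul]
  simpa [dmat_mul_const hA, Matrix.add_mul, Matrix.sum_mul, Matrix.mul_assoc, hX'] using h

lemma IsCoeffs.congr (hP : IsCoeffs k n A P) (h : ∀ i ∈ Finset.Icc 1 k, ∀ t, Q i t = P i t) :
    IsCoeffs k n A Q := by
  refine ⟨fun i hi => by rw [funext (h i hi)]; exact hP.1 i hi, fun t => ?_⟩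
  rw [← hP.2 t]
  exact congrArg _ (Finset.sum_congr rfl fun i hi => by rw [h i hi])

/-- Multiplying the equation of a fanning frame by a matrix that is dual to the block
`A^{(k-j)}` isolates the coefficient `P_j`. -/
lemma IsCoeffs.mul_dmat_eq (hP : IsCoeffs k n A P) {j : ℕ} (hj : j ∈ Finset.Icc 1 k) {t : ℝ}
    {R : Matrix (Fin n) (Fin (k * n)) ℝ}
    (hR : ∀ i < k, R * dmat i A t = if k - j = i then 1 else 0) :
    R * dmat k A t = -((k.choose j : ℝ) • P j t) := by
  have h := congrArg (R * ·) (hP.2 t)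
  simp only [Matrix.mul_add, Matrix.mul_sum, Matrix.mul_smul, Matrix.mul_zero] at h
  rw [Finset.sum_eq_single_of_mem j hj] at h
  · rw [← Matrix.mul_assoc, hR (k - j) (by have := Finset.mem_Icc.1 hj; omega), if_pos rfl,
      Matrix.one_mul] at h
    exact eq_neg_of_add_eq_zero_left h
  · intro i hi hij
    rw [Finset.mem_Icc] at hi hj
    rw [← Matrix.mul_assoc, hR _ (by omega), if_neg (by omega), Matrix.zero_mul, smul_zero]

/-- The coefficients of a fanning frame are unique. -/
lemma IsCoeffs.unique (hP : IsCoeffs k n A P) (hQ : IsCoeffs k n A Q) (hA : IsFanning k n A)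
    {j : ℕ} (hj : j ∈ Finset.Icc 1 k) (t : ℝ) : P j t = Q j t := by
  have hj' := Finset.mem_Icc.1 hj
  obtain ⟨R, -, hR⟩ := hA.exists_invRows (k - j) (by omega)
  have h := (hP.mul_dmat_eq hj fun i hi => hR i hi t).symm.trans
    (hQ.mul_dmat_eq hj fun i hi => hR i hi t)
  exact smul_right_injective _ (Nat.cast_ne_zero.2 (Nat.choose_pos hj'.2).ne') (neg_injective h)

/-- A fanning frame is determined by its coefficients up to left multiplication by a constant. -/
lemma IsCoeffs.exists_eq_mul (hk : 0 < k) (hA : IsFanning k n A) (hB : IsFanning k n B)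
    (hPA : IsCoeffs k n A P) (hPB : IsCoeffs k n B P) :
    ∃ T : Matrix (Fin (k * n)) (Fin (k * n)) ℝ, IsUnit T ∧ ∀ t, B t = T * A t := by
  set T : ℝ → Matrix (Fin (k * n)) (Fin (k * n)) ℝ :=
    fun t => frameMat k n B t * (frameMat k n A t)⁻¹
  have hTs : MatSmooth T := hB.1.frameMat.mul (hA.1.frameMat.inv hA.2)
  have hTA (t : ℝ) : T t * frameMat k n A t = frameMat k n B t := by
    rw [Matrix.mul_assoc, Matrix.nonsing_inv_mul _ ((Matrix.isUnit_iff_isUnit_det _).1 (hA.2 t)),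
      Matrix.mul_one]
  have hlt (i : ℕ) (hi : i < k) (t : ℝ) : T t * dmat i A t = dmat i B t := by
    have h := hTA t
    rw [frameMat, mul_juxt] at h
    exact congrFun (juxt_injective h) ⟨i, hi⟩
  have hle (i : ℕ) (hi : i ≤ k) (t : ℝ) : T t * dmat i A t = dmat i B t := by
    rcases hi.lt_or_eq with hi | rfl
    · exact hlt i hi t
    · rw [eq_neg_of_add_eq_zero_left (hPA.2 t), eq_neg_of_add_eq_zero_left (hPB.2 t),
        Matrix.mul_neg, Matrix.mul_sum]
      refine congrArg _ (Finset.sum_congr rfl fun j hj => ?_)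
      have hj := Finset.mem_Icc.1 hj
      rw [Matrix.mul_smul, ← Matrix.mul_assoc, hlt _ (by omega)]
  have hT' (t : ℝ) : mderiv T t = 0 := by
    have h : mderiv T t * frameMat k n A t = 0 * frameMat k n A t := by
      rw [frameMat, mul_juxt, mul_juxt]
      congr 1
      funext i
      have h := congrFun (mderiv_mul hTs (hA.1.dmat i)) t
      rw [funext (hlt i i.2), ← dmat_succ, ← dmat_succ, hle _ i.2] at h
      rw [Matrix.zero_mul]
      exact left_eq_add.1 h
    exact (hA.2 t).mul_right_cancel h
  refine ⟨T 0, (hB.2 0).mul ?_, fun t => ?_⟩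
  · exact Matrix.isUnit_nonsing_inv_iff.2 (hA.2 0)
  · rw [eq_of_mderiv_eq_zero hTs hT' 0 t]
    exact (hlt 0 hk t).symm

/-- A change of frame between two normal frames of the same curve is constant. -/
lemma mderiv_eq_zero_of_normal (hk : 2 ≤ k) (hA : IsFanning k n A)
    {X : ℝ → Matrix (Fin n) (Fin n) ℝ} (hX : MatSmooth X)
    (hP : IsCoeffs k n A P) (hP1 : ∀ t, P 1 t = 0)
    (hQ : IsCoeffs k n (fun t => A t * X t) Q) (hQ1 : ∀ t, Q 1 t = 0) (t : ℝ) :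
    mderiv X t = 0 := by
  obtain ⟨R, -, hR⟩ := hA.exists_invRows (k - 1) (by omega)
  have hRk : R t * dmat k A t = 0 := by
    rw [hP.mul_dmat_eq (j := 1) (by simp; omega) fun i hi => hR i hi t, hP1]
    simp
  have hRX (m : ℕ) : R t * dmat m (fun t => A t * X t) t =
      ∑ p ∈ Finset.HasAntidiagonal.antidiagonal m,
        m.choose p.1 • (R t * dmat p.1 A t * dmat p.2 X t) := by
    simp only [dmat_mul hA.1 hX, Matrix.mul_sum, Matrix.mul_smul, Matrix.mul_assoc]
  have hlow (m : ℕ) (hm : m + 1 < k) : R t * dmat m (fun t => A t * X t) t = 0 := by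
    rw [hRX]
    refine Finset.sum_eq_zero fun p hp => ?_
    have hp := Finset.HasAntidiagonal.mem_antidiagonal.1 hp
    rw [hR _ (by omega), if_neg (by omega), Matrix.zero_mul, smul_zero]
  have htop : R t * dmat k (fun t => A t * X t) t = k • mderiv X t := by
    rw [hRX, Finset.sum_eq_single_of_mem (k - 1, 1) (by simp; omega)]
    · rw [hR _ (by omega), if_pos rfl, Matrix.one_mul, Nat.choose_symm (by omega),
        Nat.choose_one_right]
      rfl
    · rintro ⟨i, j⟩ hp hne
      have hp := Finset.HasAntidiagonal.mem_antidiagonal.1 hp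
      simp only [ne_eq, Prod.mk.injEq, not_and] at hp hne
      rcases eq_or_ne i k with rfl | hik
      · rw [hRk, Matrix.zero_mul, smul_zero]
      · rw [hR _ (by omega), if_neg (by omega), Matrix.zero_mul, smul_zero]
  have h := congrArg (R t * ·) (hQ.2 t)
  simp only [Matrix.mul_add, Matrix.mul_sum, Matrix.mul_smul, Matrix.mul_zero] at h
  rw [htop, Finset.sum_eq_zero, add_zero] at h
  · rw [← Nat.cast_smul_eq_nsmul ℝ] at h
    exact (smul_eq_zero.1 h).resolve_left (Nat.cast_ne_zero.2 (by omega))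
  · intro i hi
    have hi := Finset.mem_Icc.1 hi
    rcases eq_or_ne i 1 with rfl | hi1
    · rw [hQ1, Matrix.mul_zero, Matrix.mul_zero, smul_zero]
    · rw [← Matrix.mul_assoc, hlow _ (by omega), Matrix.zero_mul, smul_zero]

end Frames

lemma exists_eq_mul_of_range_le {l m n : Type*} [Fintype m] [Fintype n] [DecidableEq n]
    {M : Matrix l n ℝ} {N : Matrix l m ℝ}
    (h : LinearMap.range M.mulVecLin ≤ LinearMap.range N.mulVecLin) :
    ∃ X : Matrix m n ℝ, M = N * X := by
  choose x hx using fun j : n => h ⟨Pi.single j 1, rfl⟩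
  refine ⟨Matrix.of fun i j => x j i, ?_⟩
  ext i j
  have h := congrFun (hx j) i
  rw [Matrix.mulVecLin_apply, Matrix.mulVecLin_apply, Matrix.mulVec_single_one] at h
  exact h.symm

/-- Congruence theorem: two fanning curves are congruent iff the
coefficient curves `P₂, …, P_k` of normal frames spanning them are simultaneously
conjugate by a constant invertible matrix. -/
theorem stmt_4 (k n : ℕ) (hk : 2 ≤ k) (hn : 1 ≤ n)
    (A B : ℝ → Matrix (Fin (k * n)) (Fin n) ℝ)
    (hA : IsFanning k n A) (hB : IsFanning k n B)
    (PA PB : ℕ → ℝ → Matrix (Fin n) (Fin n) ℝ)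
    (hPA : IsCoeffs k n A PA) (hPA1 : ∀ t, PA 1 t = 0)
    (hPB : IsCoeffs k n B PB) (hPB1 : ∀ t, PB 1 t = 0) :
    (∃ T : Matrix (Fin (k * n)) (Fin (k * n)) ℝ, IsUnit T ∧
        ∀ t, LinearMap.range (T * A t).mulVecLin = LinearMap.range (B t).mulVecLin) ↔
    (∃ X : Matrix (Fin n) (Fin n) ℝ, IsUnit X ∧
        ∀ i ∈ Finset.Icc 2 k, ∀ t, PB i t = X⁻¹ * PA i t * X) := by
  have hk0 : 0 < k := by omega
  constructor
  · rintro ⟨T, hT, hrange⟩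
    have hC := hA.const_mul hT
    have hPC := hPA.const_mul hA.1 T
    obtain ⟨R, hRs, hR⟩ := hC.exists_invRows 0 hk0
    have hRC (t : ℝ) : R t * (T * A t) = 1 := by simpa [dmat_zero] using hR 0 hk0 t
    choose X hX using fun t => exists_eq_mul_of_range_le (hrange t).ge
    choose Y hY using fun t => exists_eq_mul_of_range_le (hrange t).le
    have hXs : MatSmooth X := by
      have h : X = fun t => R t * B t := by
        funext t
        rw [hX, ← Matrix.mul_assoc, hRC, Matrix.one_mul]
      rw [h]
      exact hRs.mul hB.1
    rw [show B = fun t => T * A t * X t from funext hX] at hPB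
    have hconst := eq_of_mderiv_eq_zero hXs
      (mderiv_eq_zero_of_normal hk hC hXs hPC hPA1 hPB hPB1)
    have hu : IsUnit (X 0) := by
      have h : X 0 * Y 0 = 1 := by
        rw [← hRC 0, hY 0, hX 0, Matrix.mul_assoc (T * A 0), ← Matrix.mul_assoc (R 0), hRC,
          Matrix.one_mul]
      exact (Matrix.isUnit_iff_isUnit_det _).2 (Matrix.isUnit_det_of_right_inverse h)
    refine ⟨X 0, hu, fun i hi t => ?_⟩
    rw [show (fun t => T * A t * X t) = fun t => T * A t * X 0 from
      funext fun t => by rw [hconst t 0]] at hPB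
    exact hPB.unique (hPC.mul_const hC.1 hu) (hC.mul_const hu)
      (Finset.Icc_subset_Icc_left one_le_two hi) t
  · rintro ⟨X, hX, hPX⟩
    have hPC : IsCoeffs k n (fun t => A t * X) PB := by
      refine (hPA.mul_const hA.1 hX).congr fun i hi t => ?_
      rcases eq_or_ne i 1 with rfl | hi1
      · simp [hPA1, hPB1]
      · rw [Finset.mem_Icc] at hi
        exact hPX i (by rw [Finset.mem_Icc]; omega) t
    obtain ⟨T, hT, hBT⟩ := IsCoeffs.exists_eq_mul hk0 (hA.mul_const hX) hB hPC hPB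
    refine ⟨T, hT, fun t => ?_⟩
    rw [hBT, ← Matrix.mul_assoc, Matrix.mulVecLin_mul (T * A t) X,
      LinearMap.range_comp_of_range_eq_top]
    exact LinearMap.range_eq_top.2 (Matrix.mulVec_surjective_iff_isUnit.2 hX)
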